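/- arXiv:2006.13091 — 3 statements merged into one kernel-verified Lean document; each statement's English description precedes it below -/
import Mathlib

section
/- Let F1, F2, F3, G be sigma-fields on a probability space such that F1 ⊆ F2 ⊆ F1 ∨ F3, and suppose F3 is conditionally independent of G given F1. Then F3 is conditionally independent of G given F2. -/
open ProbabilityTheory MeasureTheory

/-- The intersections of a set of `m₁` with a set of `m₂` generate `m₁ ⊔ m₂`. -/
theorem MeasurableSpace.sup_eq_generateFrom_image2_inter {α : Type*} (m₁ m₂ : MeasurableSpace α) :
    m₁ ⊔ m₂ = MeasurableSpace.generateFrom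
      (Set.image2 (· ∩ ·) {s | MeasurableSet[m₁] s} {t | MeasurableSet[m₂] t}) := by
  apply le_antisymm
  · refine sup_le (fun s hs ↦ ?_) (fun t ht ↦ ?_)
    · exact .basic _ ⟨s, hs, Set.univ, @MeasurableSet.univ _ m₂, by simp⟩
    · exact .basic _ ⟨Set.univ, @MeasurableSet.univ _ m₁, t, ht, by simp⟩
  · refine MeasurableSpace.generateFrom_le ?_
    rintro _ ⟨s, hs, t, ht, rfl⟩
    exact @MeasurableSet.inter _ (m₁ ⊔ m₂) _ _ (le_sup_left (b := m₂) s hs)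
      (le_sup_right (a := m₁) t ht)

theorem MeasurableSpace.isPiSystem_image2_inter {α : Type*} (m₁ m₂ : MeasurableSpace α) :
    IsPiSystem (Set.image2 (· ∩ ·) {s | MeasurableSet[m₁] s} {t | MeasurableSet[m₂] t}) := by
  rintro _ ⟨s, hs, t, ht, rfl⟩ _ ⟨s', hs', t', ht', rfl⟩ -
  exact ⟨s ∩ s', @MeasurableSet.inter _ m₁ _ _ hs hs', t ∩ t',
    @MeasurableSet.inter _ m₂ _ _ ht ht', Set.inter_inter_inter_comm _ _ _ _⟩

/-- Integrable functions with the same integrals over the intersections of a set of `m₁` with a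
set of `m₂` have the same integrals over the sets of `m₁ ⊔ m₂`. -/
theorem MeasureTheory.setIntegral_eq_of_forall_inter {α : Type*} {m₀ : MeasurableSpace α}
    {μ : Measure α} {m₁ m₂ : MeasurableSpace α} (hm₁ : m₁ ≤ m₀) (hm₂ : m₂ ≤ m₀) {f g : α → ℝ}
    (hf : Integrable f μ) (hg : Integrable g μ)
    (h : ∀ s t, MeasurableSet[m₁] s → MeasurableSet[m₂] t →
      ∫ x in s ∩ t, f x ∂μ = ∫ x in s ∩ t, g x ∂μ)
    {u : Set α} (hu : MeasurableSet[m₁ ⊔ m₂] u) :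
    ∫ x in u, f x ∂μ = ∫ x in u, g x ∂μ := by
  have hle : m₁ ⊔ m₂ ≤ m₀ := sup_le hm₁ hm₂
  have h_univ : ∫ x, f x ∂μ = ∫ x, g x ∂μ := by
    simpa using h Set.univ Set.univ (@MeasurableSet.univ _ m₁) (@MeasurableSet.univ _ m₂)
  induction u, hu using MeasurableSpace.induction_on_inter
    (MeasurableSpace.sup_eq_generateFrom_image2_inter m₁ m₂)
    (MeasurableSpace.isPiSystem_image2_inter m₁ m₂) with
  | empty => simp
  | basic u hu =>
    obtain ⟨s, hs, t, ht, rfl⟩ := hu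
    exact h s t hs ht
  | compl u hu ih =>
    rw [setIntegral_compl (hle _ hu) hf, setIntegral_compl (hle _ hu) hg, ih, h_univ]
  | iUnion u hd hu ih =>
    rw [integral_iUnion (fun i ↦ hle _ (hu i)) hd hf.integrableOn,
      integral_iUnion (fun i ↦ hle _ (hu i)) hd hg.integrableOn]
    exact tsum_congr ih

/-- If `m₁` and `m₂` are conditionally independent given `m'`, then enlarging `m'` by `m₁` does not
change the conditional probability of a set of `m₂`. -/
theorem ProbabilityTheory.CondIndep.condExp_sup_ae_eq {Ω : Type*} {mΩ : MeasurableSpace Ω}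
    [StandardBorelSpace Ω] {μ : Measure Ω} [IsFiniteMeasure μ] {m' m₁ m₂ : MeasurableSpace Ω}
    {hm' : m' ≤ mΩ} (hm₁ : m₁ ≤ mΩ) (hm₂ : m₂ ≤ mΩ) (h : CondIndep m' m₁ m₂ hm' μ)
    {B : Set Ω} (hB : MeasurableSet[m₂] B) :
    μ⟦B | m' ⊔ m₁⟧ =ᵐ[μ] μ⟦B | m'⟧ := by
  have hBi : Integrable (B.indicator fun _ ↦ (1 : ℝ)) μ :=
    (integrable_const 1).indicator (hm₂ _ hB)
  have hB_meas : StronglyMeasurable[m' ⊔ m₁] (μ⟦B | m'⟧) :=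
    stronglyMeasurable_condExp.mono le_sup_left
  refine (ae_eq_condExp_of_forall_setIntegral_eq (sup_le hm' hm₁) hBi
    (fun _ _ _ ↦ integrable_condExp.integrableOn) (fun u hu _ ↦ ?_)
    hB_meas.aestronglyMeasurable).symm
  refine setIntegral_eq_of_forall_inter hm' hm₁ integrable_condExp hBi (fun s t hs ht ↦ ?_) hu
  have ht' := hm₁ _ ht
  have h_mul : (t.indicator fun _ ↦ (1 : ℝ)) * μ⟦B | m'⟧ = t.indicator (μ⟦B | m'⟧) := by
    ext x
    by_cases hx : x ∈ t <;> simp [hx]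
  have h_int : Integrable (t.indicator (μ⟦B | m'⟧)) μ := integrable_condExp.indicator ht'
  have h_pull : μ[t.indicator (μ⟦B | m'⟧) | m'] =ᵐ[μ] μ⟦t ∩ B | m'⟧ := by
    rw [← h_mul] at h_int ⊢
    exact (condExp_mul_of_stronglyMeasurable_right stronglyMeasurable_condExp h_int
      ((integrable_const 1).indicator ht')).trans
      ((condIndep_iff m' m₁ m₂ hm' hm₁ hm₂ μ).1 h t B ht hB).symm
  calc ∫ x in s ∩ t, (μ⟦B | m'⟧) x ∂μ
      = ∫ x in s, t.indicator (μ⟦B | m'⟧) x ∂μ := (setIntegral_indicator ht').symm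
    _ = ∫ x in s, (μ[t.indicator (μ⟦B | m'⟧) | m']) x ∂μ := (setIntegral_condExp hm' h_int hs).symm
    _ = ∫ x in s, (μ⟦t ∩ B | m'⟧) x ∂μ :=
      setIntegral_congr_ae (hm' _ hs) (h_pull.mono fun _ hx _ ↦ hx)
    _ = ∫ x in s, (t ∩ B).indicator (fun _ ↦ (1 : ℝ)) x ∂μ :=
      setIntegral_condExp hm' ((integrable_const 1).indicator (ht'.inter (hm₂ _ hB))) hs
    _ = ∫ x in s ∩ t, B.indicator (fun _ ↦ (1 : ℝ)) x ∂μ := by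
      rw [← Set.indicator_indicator, setIntegral_indicator ht']

/-- If `F1 ⊆ F2 ⊆ F1 ∨ F3` and `F3` is conditionally independent of `G` given `F1`,
then `F3` is conditionally independent of `G` given `F2`. -/
theorem stmt0 {Ω : Type*} {mΩ : MeasurableSpace Ω} [StandardBorelSpace Ω]
    (μ : Measure Ω) [IsProbabilityMeasure μ]
    (F1 F2 F3 G : MeasurableSpace Ω)
    (hF1 : F1 ≤ mΩ) (hF2 : F2 ≤ mΩ) (hF3 : F3 ≤ mΩ) (hG : G ≤ mΩ)
    (h12 : F1 ≤ F2) (h213 : F2 ≤ F1 ⊔ F3)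
    (hCI : CondIndep F1 F3 G hF1 μ) :
    CondIndep F2 F3 G hF2 μ := by
  have h_le : F1 ⊔ F3 ≤ mΩ := sup_le hF1 hF3
  rw [condIndep_iff F2 F3 G hF2 hF3 hG]
  intro A B hA hB
  have hAi : Integrable (A.indicator fun _ ↦ (1 : ℝ)) μ :=
    (integrable_const 1).indicator (hF3 _ hA)
  have hBi : Integrable (B.indicator fun _ ↦ (1 : ℝ)) μ :=
    (integrable_const 1).indicator (hG _ hB)
  have h_sup := hCI.condExp_sup_ae_eq hF3 hG hB
  have hB_meas : StronglyMeasurable[F2] (μ⟦B | F1⟧) := stronglyMeasurable_condExp.mono h12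
  have hB_eq : μ⟦B | F2⟧ =ᵐ[μ] μ⟦B | F1⟧ :=
    calc μ⟦B | F2⟧ =ᵐ[μ] μ[μ⟦B | F1 ⊔ F3⟧ | F2] := (condExp_condExp_of_le h213 h_le).symm
      _ =ᵐ[μ] μ[μ⟦B | F1⟧ | F2] := condExp_congr_ae h_sup
      _ =ᵐ[μ] μ⟦B | F1⟧ := by rw [condExp_of_stronglyMeasurable hF2 hB_meas integrable_condExp]
  have h_mul : A.indicator (μ⟦B | F1⟧) = (A.indicator fun _ ↦ (1 : ℝ)) * μ⟦B | F1⟧ := by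
    ext x
    by_cases hx : x ∈ A <;> simp [hx]
  have h_inter : μ⟦A ∩ B | F1 ⊔ F3⟧ =ᵐ[μ] A.indicator (μ⟦B | F1⟧) := by
    rw [← Set.indicator_indicator]
    refine (condExp_indicator hBi (le_sup_right (a := F1) A hA)).trans ?_
    filter_upwards [h_sup] with x hx
    simp only [Set.indicator, hx]
  calc μ⟦A ∩ B | F2⟧ =ᵐ[μ] μ[μ⟦A ∩ B | F1 ⊔ F3⟧ | F2] := (condExp_condExp_of_le h213 h_le).symm
    _ =ᵐ[μ] μ[(A.indicator fun _ ↦ (1 : ℝ)) * μ⟦B | F1⟧ | F2] :=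
      h_mul ▸ condExp_congr_ae h_inter
    _ =ᵐ[μ] μ⟦A | F2⟧ * μ⟦B | F1⟧ :=
      condExp_mul_of_stronglyMeasurable_right hB_meas
        (h_mul ▸ integrable_condExp.indicator (hF3 _ hA)) hAi
    _ =ᵐ[μ] μ⟦A | F2⟧ * μ⟦B | F2⟧ := Filter.EventuallyEq.rfl.mul hB_eq.symm
end

section
/- For each n ∈ ℕ, let (F_k^n : k ∈ ℕ) be a decreasing sequence of sigma-fields with intersection F^n, and assume the family (F_1^n : n ∈ ℕ) is (unconditionally) independent. Then ⋂_k (⋁_n F_k^n) = ⋁_n F^n up to null sets. -/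
open ProbabilityTheory MeasureTheory

theorem MeasureTheory.AEStronglyMeasurable.iInf_of_antitone {Ω : Type*} {mΩ : MeasurableSpace Ω}
    {μ : Measure Ω} {m : ℕ → MeasurableSpace Ω} (hm : Antitone m) {f : Ω → ℝ}
    (hf : ∀ k, AEStronglyMeasurable[m k] f μ) : AEStronglyMeasurable[⨅ k, m k] f μ := by
  choose g hgm hfg using hf
  refine ⟨fun ω => Filter.limsup (fun k => g k ω) Filter.atTop, ?_, ?_⟩
  · refine Measurable.stronglyMeasurable fun s hs => MeasurableSpace.measurableSet_iInf.2 fun j => ?_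
    have hshift : (fun ω => Filter.limsup (fun k => g k ω) Filter.atTop) =
        fun ω => Filter.limsup (fun k => g (k + j) ω) Filter.atTop := by
      funext ω
      exact (Filter.limsup_nat_add (fun k => g k ω) j).symm
    rw [hshift]
    have hmeas : ∀ k, Measurable[m j] (g (k + j)) := fun k =>
      (hgm (k + j)).measurable.mono (hm (Nat.le_add_left j k)) le_rfl
    exact Measurable.limsup hmeas hs
  · filter_upwards [ae_all_iff.2 hfg] with ω hω
    simp [← hω]

theorem Submodule.starProjection_tendsto_iInf {𝕜 E ι : Type*} [RCLike 𝕜] [NormedAddCommGroup E]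
    [InnerProductSpace 𝕜 E] [CompleteSpace E] [Preorder ι] (U : ι → Submodule 𝕜 E)
    [∀ i, (U i).HasOrthogonalProjection] [(⨅ i, U i).HasOrthogonalProjection]
    (hU : Antitone U) (x : E) :
    Filter.Tendsto (fun i => (U i).starProjection x) Filter.atTop
      (nhds ((⨅ i, U i).starProjection x)) := by
  have hlim := Submodule.starProjection_tendsto_closure_iSup (fun i => (U i)ᗮ)
    (fun i j hij => Submodule.orthogonal_le (hU hij)) x
  have horth : (⨆ i, (U i)ᗮ).topologicalClosureᗮ = ⨅ i, U i := by
    rw [Submodule.orthogonal_closure, ← Submodule.iInf_orthogonal]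
    simp only [Submodule.orthogonal_orthogonal]
  have hproj : (⨅ i, U i).starProjection x =
      x - (⨆ i, (U i)ᗮ).topologicalClosure.starProjection x := by
    simp only [← horth]
    exact Submodule.starProjection_orthogonal_val x
  rw [hproj]
  refine (tendsto_const_nhds.sub hlim).congr fun i => ?_
  rw [Submodule.starProjection_orthogonal_val, sub_sub_cancel]

theorem MeasureTheory.MemLp.tendsto_eLpNorm_condExp_iInf {Ω : Type*} {mΩ : MeasurableSpace Ω}
    {μ : Measure Ω} [IsFiniteMeasure μ] {m : ℕ → MeasurableSpace Ω} (hm : Antitone m)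
    (hle : ∀ k, m k ≤ mΩ) {f : Ω → ℝ} (hf : MemLp f 2 μ) :
    Filter.Tendsto (fun k => eLpNorm (μ[f | m k] - μ[f | ⨅ k, m k]) 2 μ) Filter.atTop
      (nhds 0) := by
  have hle' : ⨅ k, m k ≤ mΩ := (iInf_le m 0).trans (hle 0)
  have (k : ℕ) : Fact (m k ≤ mΩ) := ⟨hle k⟩
  have : Fact (⨅ k, m k ≤ mΩ) := ⟨hle'⟩
  have hinf : ⨅ k, lpMeas ℝ ℝ (m k) 2 μ = lpMeas ℝ ℝ (⨅ k, m k) 2 μ := by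
    ext g
    simp only [Submodule.mem_iInf, mem_lpMeas_iff_aestronglyMeasurable]
    exact ⟨AEStronglyMeasurable.iInf_of_antitone hm, fun h k => h.mono (iInf_le m k)⟩
  have hanti : Antitone fun k => lpMeas ℝ ℝ (m k) 2 μ := fun i j hij g hg => by
    rw [mem_lpMeas_iff_aestronglyMeasurable] at hg ⊢
    exact hg.mono (hm hij)
  have : (⨅ k, lpMeas ℝ ℝ (m k) 2 μ).HasOrthogonalProjection := by rw [hinf]; infer_instance
  have hlim := Submodule.starProjection_tendsto_iInf _ hanti (hf.toLp f)
  simp only [hinf] at hlim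
  rw [Lp.tendsto_Lp_iff_tendsto_eLpNorm'] at hlim
  refine hlim.congr fun k => eLpNorm_congr_ae ?_
  exact (hf.condExpL2_ae_eq_condExp (𝕜 := ℝ) (hle k)).sub
    (hf.condExpL2_ae_eq_condExp (𝕜 := ℝ) hle')

theorem Finset.abs_prod_sub_prod_le {ι : Type*} (s : Finset ι) {a b : ι → ℝ}
    (ha : ∀ i ∈ s, |a i| ≤ 1) (hb : ∀ i ∈ s, |b i| ≤ 1) :
    |∏ i ∈ s, a i - ∏ i ∈ s, b i| ≤ ∑ i ∈ s, |a i - b i| := by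
  classical
  induction s using Finset.induction_on with
  | empty => simp
  | insert i s hi ih =>
    rw [Finset.prod_insert hi, Finset.prod_insert hi, Finset.sum_insert hi]
    have ih' := ih (fun j hj => ha j (Finset.mem_insert_of_mem hj))
      (fun j hj => hb j (Finset.mem_insert_of_mem hj))
    have hprod : |∏ j ∈ s, a j| ≤ 1 := by
      rw [Finset.abs_prod]
      exact Finset.prod_le_one (fun _ _ => abs_nonneg _)
        fun j hj => ha j (Finset.mem_insert_of_mem hj)
    calc |a i * ∏ j ∈ s, a j - b i * ∏ j ∈ s, b j|
        = |(a i - b i) * ∏ j ∈ s, a j + b i * (∏ j ∈ s, a j - ∏ j ∈ s, b j)| := by ring_nf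
      _ ≤ |a i - b i| * |∏ j ∈ s, a j| + |b i| * |∏ j ∈ s, a j - ∏ j ∈ s, b j| := by
        rw [← abs_mul, ← abs_mul]
        exact abs_add_le _ _
      _ ≤ |a i - b i| + ∑ j ∈ s, |a j - b j| := by
        have hbi := hb i (Finset.mem_insert_self i s)
        gcongr
        · exact mul_le_of_le_one_right (abs_nonneg _) hprod
        · exact (mul_le_of_le_one_left (abs_nonneg _) hbi).trans ih'

theorem MeasureTheory.setIntegral_eq_of_forall_biInter {Ω ι : Type*} {mΩ : MeasurableSpace Ω}
    {μ : Measure Ω} {m : ι → MeasurableSpace Ω} (hle : ∀ i, m i ≤ mΩ) {f g : Ω → ℝ}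
    (hf : Integrable f μ) (hg : Integrable g μ)
    (h : ∀ (t : Finset ι) (c : ι → Set Ω), (∀ i ∈ t, MeasurableSet[m i] (c i)) →
      ∫ ω in ⋂ i ∈ t, c i, f ω ∂μ = ∫ ω in ⋂ i ∈ t, c i, g ω ∂μ)
    {A : Set Ω} (hA : MeasurableSet[⨆ i, m i] A) :
    ∫ ω in A, f ω ∂μ = ∫ ω in A, g ω ∂μ := by
  have hsup : ⨆ i, m i ≤ mΩ := iSup_le hle
  have huniv : ∫ ω, f ω ∂μ = ∫ ω, g ω ∂μ := by simpa using h ∅ (fun _ => ∅) (by simp)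
  have hgen : ⨆ i, m i = MeasurableSpace.generateFrom
      (piiUnionInter (fun i => {s | MeasurableSet[m i] s}) Set.univ) := by
    rw [generateFrom_piiUnionInter_measurableSet m Set.univ, iSup_univ]
  have hpi : IsPiSystem (piiUnionInter (fun i => {s | MeasurableSet[m i] s}) Set.univ) :=
    isPiSystem_piiUnionInter _ (fun i => @MeasurableSpace.isPiSystem_measurableSet Ω (m i)) _
  refine MeasurableSpace.induction_on_inter (m := ⨆ i, m i)
    (C := fun s _ => ∫ ω in s, f ω ∂μ = ∫ ω in s, g ω ∂μ) hgen hpi ?_ ?_ ?_ ?_ A hA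
  · simp
  · rintro _ ⟨t, -, c, hc, rfl⟩
    exact h t c hc
  · intro s hs ih
    rw [setIntegral_compl (hsup s hs) hf, setIntegral_compl (hsup s hs) hg, ih, huniv]
  · intro s hdisj hs ih
    rw [integral_iUnion (fun i => hsup _ (hs i)) hdisj hf.integrableOn,
      integral_iUnion (fun i => hsup _ (hs i)) hdisj hg.integrableOn]
    simp only [ih]

theorem ProbabilityTheory.iIndep.setIntegral_biInter_prod {Ω ι : Type*} {mΩ : MeasurableSpace Ω}
    {μ : Measure Ω} {m : ι → MeasurableSpace Ω} (hind : iIndep m μ) (hle : ∀ i, m i ≤ mΩ)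
    {g : ι → Ω → ℝ} (hg : ∀ i, StronglyMeasurable[m i] (g i)) {c : ι → Set Ω}
    (hc : ∀ i, MeasurableSet[m i] (c i)) (u : Finset ι) :
    ∫ ω in ⋂ i ∈ u, c i, ∏ i ∈ u, g i ω ∂μ = ∏ i ∈ u, ∫ ω in c i, g i ω ∂μ := by
  have hmeas : ∀ i, StronglyMeasurable[m i] ((c i).indicator (g i)) := fun i =>
    (hg i).indicator (hc i)
  have hfun : iIndepFun (fun (i : u) => (c i).indicator (g i)) μ :=
    iIndepFun.precomp (f := fun i => (c i).indicator (g i)) Subtype.val_injective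
      (iIndep_of_iIndep_of_le hind fun i => (hmeas i).measurable.comap_le)
  have hprod := hfun.integral_fun_prod_eq_prod_integral
    fun i => ((hmeas i).mono (hle i)).aestronglyMeasurable
  rw [← integral_indicator (u.measurableSet_biInter fun i _ => hle i _ (hc i))]
  rw [Finset.prod_coe_sort u fun i => ∫ ω, (c i).indicator (g i) ω ∂μ] at hprod
  simp only [fun ω => Finset.prod_coe_sort u fun i => (c i).indicator (g i) ω] at hprod
  simp only [← integral_indicator (hle _ _ (hc _)), ← hprod]
  congr 1 with ω
  by_cases hω : ω ∈ ⋂ i ∈ u, c i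
  · rw [Set.indicator_of_mem hω]
    refine Finset.prod_congr rfl fun i hi => ?_
    rw [Set.indicator_of_mem (Set.mem_iInter₂.1 hω i hi)]
  · rw [Set.indicator_of_notMem hω]
    simp only [Set.mem_iInter, not_forall] at hω
    obtain ⟨i, hi, hi'⟩ := hω
    exact (Finset.prod_eq_zero hi (Set.indicator_of_notMem hi' _)).symm

theorem MeasureTheory.integrable_finset_prod_of_abs_le_one {Ω ι : Type*}
    {mΩ : MeasurableSpace Ω} {μ : Measure Ω} [IsFiniteMeasure μ] {f : ι → Ω → ℝ}
    (hf : ∀ i, AEStronglyMeasurable (f i) μ) (hbdd : ∀ i, ∀ᵐ ω ∂μ, |f i ω| ≤ 1)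
    (s : Finset ι) : Integrable (fun ω => ∏ i ∈ s, f i ω) μ := by
  refine Integrable.of_bound (Finset.aestronglyMeasurable_fun_prod s fun i _ => hf i) 1 ?_
  filter_upwards [(Filter.eventually_all_finset s).2 fun i _ => hbdd i] with ω hω
  rw [Real.norm_eq_abs, Finset.abs_prod]
  exact Finset.prod_le_one (fun _ _ => abs_nonneg _) hω

theorem ProbabilityTheory.iIndep.setIntegral_prod_condExp {Ω ι : Type*}
    {mΩ : MeasurableSpace Ω} {μ : Measure Ω} [IsFiniteMeasure μ] {m₁ m₂ : ι → MeasurableSpace Ω}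
    (hind : iIndep m₂ μ) (hm : ∀ i, m₁ i ≤ m₂ i) (hle : ∀ i, m₂ i ≤ mΩ) {f : ι → Ω → ℝ}
    (hf : ∀ i, StronglyMeasurable[m₂ i] (f i)) (hbdd : ∀ i ω, |f i ω| ≤ 1) (s : Finset ι)
    {A : Set Ω} (hA : MeasurableSet[⨆ i, m₁ i] A) :
    ∫ ω in A, ∏ i ∈ s, (μ[f i | m₁ i]) ω ∂μ = ∫ ω in A, ∏ i ∈ s, f i ω ∂μ := by
  classical
  have hle₁ : ∀ i, m₁ i ≤ mΩ := fun i => (hm i).trans (hle i)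
  have hfm : ∀ i, AEStronglyMeasurable (f i) μ := fun i =>
    ((hf i).mono (hle i)).aestronglyMeasurable
  refine setIntegral_eq_of_forall_biInter hle₁
    (integrable_finset_prod_of_abs_le_one
      (fun i => (stronglyMeasurable_condExp.mono (hle₁ i)).aestronglyMeasurable)
      (fun i => ae_bdd_norm_condExp_of_ae_bdd_norm (E := ℝ) (.of_forall (hbdd i))) s)
    (integrable_finset_prod_of_abs_le_one hfm (fun i => .of_forall (hbdd i)) s)
    (fun t c hc => ?_) hA
  have hinter : ⋂ i ∈ t, c i = ⋂ i ∈ s ∪ t, if i ∈ t then c i else Set.univ := by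
    ext ω
    simp only [Set.mem_iInter, Finset.mem_union]
    exact ⟨fun h i _ => by split_ifs with hi <;> simp [h, hi],
      fun h i hi => by simpa [hi] using h i (.inr hi)⟩
  have hc' : ∀ i, MeasurableSet[m₁ i] (if i ∈ t then c i else Set.univ) := fun i => by
    split_ifs with hi
    · exact hc i hi
    · exact MeasurableSet.univ
  have hextend : ∀ g : ι → Ω → ℝ, (∀ i, StronglyMeasurable[m₂ i] (g i)) →
      ∫ ω in ⋂ i ∈ t, c i, ∏ i ∈ s, g i ω ∂μ = ∏ i ∈ s ∪ t,
        ∫ ω in if i ∈ t then c i else Set.univ, (if i ∈ s then g i else 1) ω ∂μ := by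
    intro g hg
    rw [← hind.setIntegral_biInter_prod hle (g := fun i => if i ∈ s then g i else 1) ?_
      fun i => hm i _ (hc' i), hinter]
    · congr 1 with ω
      rw [← Finset.prod_subset Finset.subset_union_left (fun i _ hi => by simp [hi])]
      exact Finset.prod_congr rfl fun i hi => by simp [hi]
    · intro i
      split_ifs
      · exact hg i
      · exact stronglyMeasurable_one
  rw [hextend _ fun i => stronglyMeasurable_condExp.mono (hm i), hextend f hf]
  refine Finset.prod_congr rfl fun i _ => ?_
  by_cases hi : i ∈ s
  · simp only [hi, if_true]
    exact setIntegral_condExp (hle₁ i) (.of_bound (hfm i) 1 (.of_forall (hbdd i))) (hc' i)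
  · simp [hi]

theorem MeasureTheory.integral_condExp_mul_eq_integral_mul_condExp {Ω : Type*}
    {m mΩ : MeasurableSpace Ω} {μ : Measure Ω} [IsFiniteMeasure μ] (hm : m ≤ mΩ) {f g : Ω → ℝ}
    (hf : MemLp f 2 μ) (hg : MemLp g 2 μ) :
    ∫ ω, (μ[f | m]) ω * g ω ∂μ = ∫ ω, f ω * (μ[g | m]) ω ∂μ := by
  have hf' : Integrable f μ := hf.integrable one_le_two
  have hg' : Integrable g μ := hg.integrable one_le_two
  have hl := condExp_mul_of_stronglyMeasurable_left (stronglyMeasurable_condExp (f := f) (m := m))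
    ((hf.condExp one_le_two).integrable_mul hg) hg'
  have hr := condExp_mul_of_stronglyMeasurable_right (stronglyMeasurable_condExp (f := g) (m := m))
    (hf.integrable_mul (hg.condExp one_le_two)) hf'
  have := integral_congr_ae (hl.trans hr.symm)
  rwa [integral_condExp hm, integral_condExp hm] at this

theorem ProbabilityTheory.iIndep.setIntegral_prod_condExp_iInf {Ω ι : Type*}
    {mΩ : MeasurableSpace Ω} {μ : Measure Ω} [IsProbabilityMeasure μ]
    {m : ι → ℕ → MeasurableSpace Ω} (hle : ∀ i k, m i k ≤ mΩ) (hanti : ∀ i, Antitone (m i))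
    (hind : iIndep (fun i => m i 0) μ) {f : ι → Ω → ℝ}
    (hf : ∀ i, StronglyMeasurable[m i 0] (f i)) (hbdd : ∀ i ω, |f i ω| ≤ 1) (s : Finset ι)
    {A : Set Ω} (hA : MeasurableSet[⨅ k, ⨆ i, m i k] A) :
    ∫ ω in A, ∏ i ∈ s, (μ[f i | ⨅ k, m i k]) ω ∂μ = ∫ ω in A, ∏ i ∈ s, f i ω ∂μ := by
  have hfm : ∀ i, AEStronglyMeasurable (f i) μ := fun i =>
    ((hf i).mono (hle i 0)).aestronglyMeasurable
  have hbound : ∀ m' i, ∀ᵐ ω ∂μ, |(μ[f i | m']) ω| ≤ 1 := fun m' i =>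
    ae_bdd_norm_condExp_of_ae_bdd_norm (E := ℝ) (.of_forall (hbdd i))
  have hint : ∀ m' : ι → MeasurableSpace Ω,
      Integrable (fun ω => ∏ i ∈ s, (μ[f i | m' i]) ω) μ := fun m' =>
    integrable_finset_prod_of_abs_le_one (fun i => integrable_condExp.aestronglyMeasurable)
      (fun i => hbound (m' i) i) s
  have hdiff : ∀ i k, Integrable (fun ω => |(μ[f i | m i k]) ω - (μ[f i | ⨅ k, m i k]) ω|) μ :=
    fun i k => (integrable_condExp.sub integrable_condExp).abs
  have hL1 : ∀ i, Filter.Tendsto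
      (fun k => ∫ ω, |(μ[f i | m i k]) ω - (μ[f i | ⨅ k, m i k]) ω| ∂μ)
      Filter.atTop (nhds 0) := by
    intro i
    have hlim := MemLp.tendsto_eLpNorm_condExp_iInf (μ := μ) (hanti i) (hle i)
      (.of_bound (hfm i) 1 (.of_forall (hbdd i)))
    have hlim₁ := tendsto_of_tendsto_of_tendsto_of_le_of_le tendsto_const_nhds hlim
      (fun _ => zero_le) fun k => eLpNorm_le_eLpNorm_of_exponent_le (p := 1) one_le_two
        (integrable_condExp.sub integrable_condExp).aestronglyMeasurable
    refine ((ENNReal.tendsto_toReal ENNReal.zero_ne_top).comp hlim₁).congr fun k => ?_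
    rw [Function.comp_apply, eLpNorm_one_eq_lintegral_enorm,
      ← integral_norm_eq_lintegral_enorm
        (integrable_condExp.sub integrable_condExp).aestronglyMeasurable]
    rfl
  have hsum := tendsto_finsetSum s fun i _ => hL1 i
  rw [Finset.sum_const_zero] at hsum
  have hconst : ∀ k, |∫ ω in A, ∏ i ∈ s, f i ω ∂μ -
      ∫ ω in A, ∏ i ∈ s, (μ[f i | ⨅ k, m i k]) ω ∂μ| ≤
      ∑ i ∈ s, ∫ ω, |(μ[f i | m i k]) ω - (μ[f i | ⨅ k, m i k]) ω| ∂μ := by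
    intro k
    rw [← hind.setIntegral_prod_condExp (fun i => hanti i (Nat.zero_le k)) (fun i => hle i 0)
      hf hbdd s (MeasurableSpace.measurableSet_iInf.1 hA k),
      ← integral_sub (hint _).integrableOn (hint _).integrableOn,
      ← integral_finsetSum s fun i _ => hdiff i k]
    refine abs_integral_le_integral_abs.trans ?_
    refine (setIntegral_le_integral ((hint _).sub (hint _)).abs
      (.of_forall fun _ => abs_nonneg _)).trans ?_
    refine integral_mono_ae ((hint _).sub (hint _)).abs
      (integrable_finsetSum s fun i _ => hdiff i k) ?_
    filter_upwards [(Filter.eventually_all_finset s).2 fun i _ => hbound (m i k) i,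
      (Filter.eventually_all_finset s).2 fun i _ => hbound (⨅ k, m i k) i] with ω h₁ h₂
    exact s.abs_prod_sub_prod_le h₁ h₂
  have hzero := ge_of_tendsto' hsum hconst
  exact (sub_eq_zero.1 (abs_nonpos_iff.1 hzero)).symm

theorem ProbabilityTheory.iIndep.prod_condExp_ae_eq {Ω ι : Type*}
    {mΩ : MeasurableSpace Ω} {μ : Measure Ω} [IsFiniteMeasure μ] {m₁ m₂ : ι → MeasurableSpace Ω}
    (hind : iIndep m₂ μ) (hm : ∀ i, m₁ i ≤ m₂ i) (hle : ∀ i, m₂ i ≤ mΩ) {f : ι → Ω → ℝ}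
    (hf : ∀ i, StronglyMeasurable[m₂ i] (f i)) (hbdd : ∀ i ω, |f i ω| ≤ 1) (s : Finset ι) :
    (fun ω => ∏ i ∈ s, (μ[f i | m₁ i]) ω) =ᵐ[μ] μ[fun ω => ∏ i ∈ s, f i ω | ⨆ i, m₁ i] := by
  have hle₁ : ∀ i, m₁ i ≤ mΩ := fun i => (hm i).trans (hle i)
  refine ae_eq_condExp_of_forall_setIntegral_eq (iSup_le hle₁)
    (integrable_finset_prod_of_abs_le_one (fun i => ((hf i).mono (hle i)).aestronglyMeasurable)
      (fun i => .of_forall (hbdd i)) s) (fun A _ _ => ?_)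
    (fun A hA _ => hind.setIntegral_prod_condExp hm hle hf hbdd s hA) ?_
  · exact (integrable_finset_prod_of_abs_le_one
      (fun i => integrable_condExp.aestronglyMeasurable)
      (fun i => ae_bdd_norm_condExp_of_ae_bdd_norm (E := ℝ) (.of_forall (hbdd i)))
      s).integrableOn
  · exact (Finset.stronglyMeasurable_fun_prod s fun i _ =>
      stronglyMeasurable_condExp.mono (le_iSup m₁ i)).aestronglyMeasurable

theorem ProbabilityTheory.iIndep.indicator_ae_eq_condExp_iSup_iInf {Ω ι : Type*}
    {mΩ : MeasurableSpace Ω} {μ : Measure Ω} [IsProbabilityMeasure μ]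
    {m : ι → ℕ → MeasurableSpace Ω} (hle : ∀ i k, m i k ≤ mΩ) (hanti : ∀ i, Antitone (m i))
    (hind : iIndep (fun i => m i 0) μ) {A : Set Ω} (hA : MeasurableSet[⨅ k, ⨆ i, m i k] A) :
    A.indicator (fun _ => (1 : ℝ)) =ᵐ[μ]
      μ[A.indicator (fun _ => (1 : ℝ)) | ⨆ i, ⨅ k, m i k] := by
  have hA₀ : MeasurableSet[⨆ i, m i 0] A := MeasurableSpace.measurableSet_iInf.1 hA 0
  have hsup : ⨆ i, m i 0 ≤ mΩ := iSup_le fun i => hle i 0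
  have hAΩ : MeasurableSet A := hsup A hA₀
  have hinf : ⨆ i, ⨅ k, m i k ≤ ⨆ i, m i 0 := iSup_mono fun i => iInf_le _ 0
  have hAint : Integrable (A.indicator fun _ => (1 : ℝ)) μ :=
    (integrable_const 1).indicator hAΩ
  refine ae_eq_of_forall_setIntegral_eq_of_sigmaFinite' hsup (fun _ _ _ => hAint.integrableOn)
    (fun _ _ _ => integrable_condExp.integrableOn) (fun C hC _ => ?_)
    (stronglyMeasurable_const.indicator hA₀).aestronglyMeasurable
    (stronglyMeasurable_condExp.mono hinf).aestronglyMeasurable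
  refine setIntegral_eq_of_forall_biInter (fun i => hle i 0) hAint integrable_condExp
    (fun t c hc => ?_) hC
  classical
  set f : ι → Ω → ℝ := fun i => if i ∈ t then (c i).indicator (fun _ => 1) else 0 with hf_def
  have hf : ∀ i, StronglyMeasurable[m i 0] (f i) := fun i => by
    simp only [hf_def]
    split_ifs with hi
    · exact stronglyMeasurable_const.indicator (hc i hi)
    · exact stronglyMeasurable_zero
  have hbdd : ∀ i ω, |f i ω| ≤ 1 := fun i ω => by
    simp only [hf_def]
    split_ifs with hi
    · by_cases hω : ω ∈ c i <;> simp [hω]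
    · simp
  have hcm : MeasurableSet (⋂ i ∈ t, c i) :=
    t.measurableSet_biInter fun i hi => hle i 0 _ (hc i hi)
  have hprod : (fun ω => ∏ i ∈ t, f i ω) = (⋂ i ∈ t, c i).indicator fun _ => (1 : ℝ) := by
    funext ω
    by_cases hω : ω ∈ ⋂ i ∈ t, c i
    · rw [Set.indicator_of_mem hω]
      refine Finset.prod_eq_one fun i hi => ?_
      simp [hf_def, hi, Set.mem_iInter₂.1 hω i hi]
    · rw [Set.indicator_of_notMem hω]
      simp only [Set.mem_iInter, not_forall] at hω
      obtain ⟨i, hi, hi'⟩ := hω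
      exact Finset.prod_eq_zero hi (by simp [hf_def, hi, hi'])
  have hswap : ∀ {B : Set Ω} (_ : MeasurableSet B) (g : Ω → ℝ),
      ∫ ω in B, g ω ∂μ = ∫ ω, B.indicator (fun _ => (1 : ℝ)) ω * g ω ∂μ := fun hB g => by
    rw [← integral_indicator hB]
    congr 1 with ω
    simp [Set.indicator_apply]
  have hmem : ∀ {B : Set Ω} (_ : MeasurableSet B),
      MemLp (B.indicator fun _ => (1 : ℝ)) 2 μ := fun hB =>
    memLp_indicator_const 2 hB 1 (.inr (measure_ne_top μ _))
  calc ∫ ω in ⋂ i ∈ t, c i, A.indicator (fun _ => (1 : ℝ)) ω ∂μ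
      = ∫ ω in A, ∏ i ∈ t, f i ω ∂μ := by
        rw [hswap hcm, hprod, hswap hAΩ]
        simp only [mul_comm]
    _ = ∫ ω in A, (μ[fun ω => ∏ i ∈ t, f i ω | ⨆ i, ⨅ k, m i k]) ω ∂μ := by
        rw [← hind.setIntegral_prod_condExp_iInf hle hanti hf hbdd t hA]
        exact integral_congr_ae (ae_restrict_of_ae (hind.prod_condExp_ae_eq
          (fun i => iInf_le _ 0) (fun i => hle i 0) hf hbdd t))
    _ = ∫ ω in ⋂ i ∈ t, c i, (μ[A.indicator (fun _ => (1 : ℝ)) | ⨆ i, ⨅ k, m i k]) ω ∂μ := by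
        rw [hswap hcm, hprod, hswap hAΩ, ← integral_condExp_mul_eq_integral_mul_condExp
          (hinf.trans hsup) (hmem hAΩ) (hmem hcm)]
        simp only [mul_comm]

/-- If for each `n` the sequence `k ↦ F n k` of sigma-fields is decreasing with
intersection `⨅ k, F n k`, and the family `(F n 0 : n)` is independent, then
`⨅ k, ⨆ n, F n k = ⨆ n, ⨅ k, F n k` up to null sets. -/
theorem stmt5 {Ω : Type*} {mΩ : MeasurableSpace Ω}
    (μ : Measure Ω) [IsProbabilityMeasure μ]
    (F : ℕ → ℕ → MeasurableSpace Ω)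
    (hF : ∀ n k, F n k ≤ mΩ)
    (hanti : ∀ n, Antitone (fun k => F n k))
    (hind : iIndep (fun n => F n 0) μ) :
    (∀ A : Set Ω, MeasurableSet[⨅ k, ⨆ n, F n k] A →
      ∃ B : Set Ω, MeasurableSet[⨆ n, ⨅ k, F n k] B ∧ μ (symmDiff A B) = 0) ∧
    (∀ B : Set Ω, MeasurableSet[⨆ n, ⨅ k, F n k] B →
      ∃ A : Set Ω, MeasurableSet[⨅ k, ⨆ n, F n k] A ∧ μ (symmDiff A B) = 0) := by
  refine ⟨fun A hA => ?_, fun B hB => ⟨B, ?_, by simp⟩⟩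
  · have hae := hind.indicator_ae_eq_condExp_iSup_iInf hF hanti hA
    refine ⟨(μ[A.indicator (fun _ => (1 : ℝ)) | ⨆ n, ⨅ k, F n k]) ⁻¹' {1},
      stronglyMeasurable_condExp.measurable (measurableSet_singleton 1), ?_⟩
    rw [measure_symmDiff_eq_zero_iff]
    filter_upwards [hae] with ω hω
    refine propext ?_
    change ω ∈ A ↔ (μ[A.indicator (fun _ => (1 : ℝ)) | ⨆ n, ⨅ k, F n k]) ω = 1
    rw [← hω]
    by_cases h : ω ∈ A <;> simp [h]
  · exact iSup_iInf_le_iInf_iSup (fun n k => F n k) B hB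
end

section
/- Let X, Y, Z be random elements with X taking values in a Borel space. Then X is conditionally independent of Z given Y if and only if there exist a measurable function f and a uniform-[0,1] random variable U independent of (Y, Z) such that X = f(Y, U) almost surely (on a possibly extended probability space). -/
open ProbabilityTheory MeasureTheory

section RandomizationKernel

variable {Ω α β γ : Type*} {mΩ : MeasurableSpace Ω}
  {mα : MeasurableSpace α} {mβ : MeasurableSpace β} {mγ : MeasurableSpace γ}

/-- `X` and `Z` are conditionally independent given `Y` iff the conditional law of `X` given
`(Y, Z)` is given by a Markov kernel depending on `Y` only. -/
theorem condIndepFun_iff_exists_map_eq_compProd_prodMkRight [StandardBorelSpace Ω]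
    [StandardBorelSpace α] [Nonempty α] [StandardBorelSpace γ]
    (μ : Measure Ω) [IsProbabilityMeasure μ] {X : Ω → α} {Y : Ω → β} {Z : Ω → γ}
    (hX : Measurable X) (hY : Measurable Y) (hZ : Measurable Z) :
    CondIndepFun (MeasurableSpace.comap Y mβ) hY.comap_le X Z μ ↔
      ∃ κ : Kernel β α, IsMarkovKernel κ ∧
        μ.map (fun ω => ((Y ω, Z ω), X ω)) =
          μ.map (fun ω => (Y ω, Z ω)) ⊗ₘ κ.prodMkRight γ := by
  obtain ⟨ω₀⟩ := μ.nonempty_of_neZero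
  have : Nonempty γ := ⟨Z ω₀⟩
  have hYZ : Measurable fun ω => (Y ω, Z ω) := hY.prodMk hZ
  have key := condIndepFun_iff_condDistrib_prod_ae_eq_prodMkRight (μ := μ) hX hZ hY
  constructor
  · intro h
    refine ⟨condDistrib X Y μ, inferInstance, ?_⟩
    exact (condDistrib_ae_eq_iff_measure_eq_compProd _ hX.aemeasurable _).1 (key.1 h.symm)
  · rintro ⟨κ, hκ, h⟩
    refine CondIndepFun.symm (key.2 ?_)
    have hXY : μ.map (fun ω => (Y ω, X ω)) = μ.map Y ⊗ₘ κ := by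
      have e : (fun ω => (Y ω, X ω)) = Prod.map Prod.fst id ∘ fun ω => ((Y ω, Z ω), X ω) := rfl
      have e' : μ.map Y = (μ.map (fun ω => (Y ω, Z ω))).map Prod.fst := by
        rw [Measure.map_map measurable_fst hYZ]; rfl
      rw [e, ← Measure.map_map (by fun_prop) (by fun_prop), h, e']
      ext s hs
      rw [Measure.map_apply (by fun_prop) hs, Measure.compProd_apply (by measurability),
        Measure.compProd_apply hs, lintegral_map (Kernel.measurable_kernel_prodMk_left hs)
          measurable_fst]
      rfl
    have hκ' : condDistrib X Y μ =ᵐ[μ.map Y] κ :=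
      condDistrib_ae_eq_of_measure_eq_compProd _ hX.aemeasurable hXY
    have hprod := condDistrib_ae_eq_of_measure_eq_compProd (fun ω => (Y ω, Z ω))
      hX.aemeasurable h
    have hfst : ∀ᵐ p ∂μ.map (fun ω => (Y ω, Z ω)), condDistrib X Y μ p.1 = κ p.1 := by
      refine ae_of_ae_map (f := Prod.fst) (p := fun y => condDistrib X Y μ y = κ y)
        measurable_fst.aemeasurable ?_
      rw [Measure.map_map measurable_fst hYZ]
      exact hκ'
    filter_upwards [hprod, hfst] with p hp hp'
    rw [hp, Kernel.prodMkRight_apply, Kernel.prodMkRight_apply, hp']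

/-- Composing a measure on `β × γ` with the kernel `y ↦ ρ.map (f (y, ·))` amounts to applying `f`
to the first coordinate and an independent `ρ`-distributed variable. -/
theorem compProd_prodMkRight_eq_map_prod {δ : Type*} {mδ : MeasurableSpace δ}
    (ν : Measure (β × γ)) [SFinite ν] (ρ : Measure δ) [SFinite ρ]
    {f : β × δ → α} (hf : Measurable f) (κ : Kernel β α) [IsSFiniteKernel κ]
    (hκ : ∀ y, κ y = ρ.map (fun u => f (y, u))) :
    ν ⊗ₘ κ.prodMkRight γ = (ν.prod ρ).map (fun p => (p.1, f (p.1.1, p.2))) := by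
  have hm : Measurable fun p : (β × γ) × δ => (p.1, f (p.1.1, p.2)) := by fun_prop
  ext s hs
  rw [Measure.compProd_apply hs, Measure.map_apply hm hs, Measure.prod_apply (hm hs)]
  refine lintegral_congr fun p => ?_
  rw [Kernel.prodMkRight_apply, hκ, Measure.map_apply (by fun_prop) (measurable_prodMk_left hs)]
  rfl

/-- The image of the uniform law on `[0, 1]` under the retraction `ℝ → [0, 1]` is the volume. -/
theorem map_projIcc_restrict_Icc :
    (volume.restrict (Set.Icc (0 : ℝ) 1)).map (Set.projIcc 0 1 zero_le_one) =
      (volume : Measure unitInterval) := by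
  have h : Measure.map ((↑) : unitInterval → ℝ) volume = volume.restrict (Set.Icc (0 : ℝ) 1) :=
    map_comap_subtype_coe measurableSet_Icc volume
  rw [← h, Measure.map_map continuous_projIcc.measurable measurable_subtype_coe]
  convert Measure.map_id
  ext x
  simp

/-- A Markov kernel into a standard Borel space is the image of the uniform law on `[0, 1]`
under a jointly measurable map. -/
theorem exists_measurable_map_restrict_Icc_eq [StandardBorelSpace α] [Nonempty α]
    (κ : Kernel β α) [IsMarkovKernel κ] :
    ∃ f : β × ℝ → α, Measurable f ∧
      ∀ y, κ y = (volume.restrict (Set.Icc (0 : ℝ) 1)).map (fun u => f (y, u)) := by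
  obtain ⟨g, hg, hgκ⟩ := κ.exists_measurable_map_eq_unitInterval
  have hp : Measurable (Set.projIcc (0 : ℝ) 1 zero_le_one) := continuous_projIcc.measurable
  refine ⟨fun p => g p.1 (Set.projIcc 0 1 zero_le_one p.2), ?_, fun y => ?_⟩
  · exact hg.comp (measurable_fst.prodMk (hp.comp measurable_snd))
  · rw [← hgκ, ← map_projIcc_restrict_Icc, Measure.map_map hg.of_uncurry_left hp]
    rfl

end RandomizationKernel

/-- `X` is conditionally independent of `Z` given `Y` iff, on a possibly extended
probability space (with the same joint law of `(X, Y, Z)`), there exist a measurable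
`f` and a uniform-[0,1] variable `U` independent of `(Y, Z)` with `X = f (Y, U)`
almost surely. -/
theorem stmt17 {Ω α β γ : Type*} {mΩ : MeasurableSpace Ω} [StandardBorelSpace Ω]
    {mα : MeasurableSpace α} {mβ : MeasurableSpace β} {mγ : MeasurableSpace γ}
    [StandardBorelSpace α] [StandardBorelSpace β] [StandardBorelSpace γ] [Nonempty α]
    (μ : Measure Ω) [IsProbabilityMeasure μ]
    (X : Ω → α) (Y : Ω → β) (Z : Ω → γ)
    (hX : Measurable X) (hY : Measurable Y) (hZ : Measurable Z) :
    CondIndepFun (MeasurableSpace.comap Y mβ) hY.comap_le X Z μ ↔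
      ∃ (Ω' : Type) (mΩ' : MeasurableSpace Ω') (μ' : Measure Ω')
        (_ : IsProbabilityMeasure μ')
        (X' : Ω' → α) (Y' : Ω' → β) (Z' : Ω' → γ) (U : Ω' → ℝ) (f : β × ℝ → α),
        Measurable X' ∧ Measurable Y' ∧ Measurable Z' ∧ Measurable U ∧ Measurable f ∧
        μ'.map (fun ω => (X' ω, Y' ω, Z' ω)) = μ.map (fun ω => (X ω, Y ω, Z ω)) ∧
        μ'.map U = volume.restrict (Set.Icc (0 : ℝ) 1) ∧
        IndepFun U (fun ω => (Y' ω, Z' ω)) μ' ∧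
        ∀ᵐ ω ∂μ', X' ω = f (Y' ω, U ω) := by
  obtain ⟨ω₀⟩ := μ.nonempty_of_neZero
  have : Nonempty (β × γ) := ⟨(Y ω₀, Z ω₀)⟩
  have : IsProbabilityMeasure (volume.restrict (Set.Icc (0 : ℝ) 1)) := ⟨by simp⟩
  set ρ : Measure ℝ := volume.restrict (Set.Icc (0 : ℝ) 1)
  have hYZ : Measurable fun ω => (Y ω, Z ω) := hY.prodMk hZ
  have : IsProbabilityMeasure (μ.map fun ω => (Y ω, Z ω)) :=
    Measure.isProbabilityMeasure_map hYZ.aemeasurable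
  set ν : Measure (β × γ) := μ.map fun ω => (Y ω, Z ω)
  rw [condIndepFun_iff_exists_map_eq_compProd_prodMkRight μ hX hY hZ]
  constructor
  · rintro ⟨κ, hκ, h⟩
    obtain ⟨f, hf, hfκ⟩ := exists_measurable_map_restrict_Icc_eq κ
    have he := measurableEmbedding_embeddingReal (β × γ)
    let d : ℝ → β × γ := he.invFun
    have hd : Measurable d := he.measurable_invFun
    let ν' : Measure ℝ := ν.map (embeddingReal (β × γ))
    have : IsProbabilityMeasure ν' := Measure.isProbabilityMeasure_map he.measurable.aemeasurable
    have hν' : ν'.map d = ν := by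
      rw [Measure.map_map hd he.measurable, Function.LeftInverse.id he.leftInverse_invFun,
        Measure.map_id]
    have hpair : (ν'.prod ρ).map (fun ω => (d ω.1, ω.2)) = ν.prod ρ := by
      have h2 := Measure.map_prod_map ν' ρ hd measurable_id
      rw [Measure.map_id, hν'] at h2
      exact h2.symm
    refine ⟨ℝ × ℝ, inferInstance, ν'.prod ρ, inferInstance,
      fun ω => f ((d ω.1).1, ω.2), fun ω => (d ω.1).1, fun ω => (d ω.1).2, Prod.snd, f,
      by fun_prop, by fun_prop, by fun_prop, by fun_prop, hf, ?_, ?_, ?_, by simp⟩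
    · rw [compProd_prodMkRight_eq_map_prod ν ρ hf κ hfκ] at h
      have h2 := congrArg (Measure.map fun p : (β × γ) × α => (p.2, p.1.1, p.1.2)) h
      rw [Measure.map_map (by fun_prop) (by fun_prop), ← hpair,
        Measure.map_map (by fun_prop) (by fun_prop),
        Measure.map_map (by fun_prop) (by fun_prop)] at h2
      exact h2.symm
    · simp [Measure.map_snd_prod]
    · exact (indepFun_prod (μ := ν') (ν := ρ) hd measurable_id).symm
  · rintro ⟨Ω', mΩ', μ', hμ', X', Y', Z', U, f, hX', hY', hZ', hU, hf, hlaw, hunif, hind, hae⟩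
    have hν' : μ'.map (fun ω => (Y' ω, Z' ω)) = ν := by
      have h2 := congrArg (Measure.map Prod.snd) hlaw
      rwa [Measure.map_map (by fun_prop) (by fun_prop),
        Measure.map_map (by fun_prop) (by fun_prop)] at h2
    have hjoint : μ'.map (fun ω => ((Y' ω, Z' ω), U ω)) = ν.prod ρ := by
      rw [(indepFun_iff_map_prod_eq_prod_map_map (by fun_prop) (by fun_prop)).1 hind.symm,
        hν', hunif]
    let κ : Kernel β α := (Kernel.id ×ₖ Kernel.const β ρ).map f
    have hκ : IsMarkovKernel κ := Kernel.IsMarkovKernel.map _ hf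
    refine ⟨κ, hκ, ?_⟩
    rw [compProd_prodMkRight_eq_map_prod ν ρ hf κ, ← hjoint,
      Measure.map_map (by fun_prop) (by fun_prop)]
    · have h2 := congrArg (Measure.map fun p : α × β × γ => (p.2, p.1)) hlaw
      rw [Measure.map_map (by fun_prop) (by fun_prop),
        Measure.map_map (by fun_prop) (by fun_prop)] at h2
      refine h2.symm.trans (Measure.map_congr ?_)
      filter_upwards [hae] with ω hω
      simp [hω]
    · intro y
      rw [Kernel.map_apply _ hf, Kernel.prod_apply, Kernel.id_apply, Kernel.const_apply,
        Measure.dirac_prod, Measure.map_map hf (by fun_prop)]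
      rfl
end
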